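/- Let u ∈ L^{p-1}(Ω,ν) with p > 2, and suppose ū extends u to Ω_m with the Dipierro–Ros-Oton–Valdinoci boundary condition -∫_Ω a_p(x,y,ū(y)-ū(x)) dm_x(y) = φ(x) for x ∈ ∂_mΩ, where a_p satisfies |a_p(x,y,r)| ≤ C(1+|r|^{p-1}) and a_p(x,y,r)r ≥ c|r|^p, and φ ∈ L^1(∂_mΩ,ν). If Θ := ∫_{∂_mΩ}∫_Ω |ū(y)-ū(x)|^{p-1} dm_x(y)dν(x), then Θ ≤ (1+2C/c)ν(Ω_m) + (1/c)‖φ‖_{L^1(∂_mΩ,ν)} + (1+2C/c)·Θ^{(p-2)/(p-1)}·‖u‖_{L^{p-1}(Ω,ν)}; consequently Θ < +∞ whenever the right-hand side bound forces finiteness (i.e. Θ satisfies the self-improving inequality Θ ≤ A + BΘ^{(p-2)/(p-1)} with A, B < ∞, hence Θ is finite). -/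

import Mathlib

open MeasureTheory ProbabilityTheory ENNReal

/-- The `m`-boundary of `Ω`. -/
def mBoundary {X : Type*} [MeasurableSpace X] (κ : Kernel X X) (Ω : Set X) : Set X :=
  {x | x ∉ Ω ∧ 0 < κ x Ω}

/-- The `m`-closure of `Ω`. -/
def mClosure {X : Type*} [MeasurableSpace X] (κ : Kernel X X) (Ω : Set X) : Set X :=
  Ω ∪ mBoundary κ Ω

/-- `Θ := ∫_{∂_mΩ} ∫_Ω |u(y) - u(x)|^{p-1} dm_x(y) dν(x)`. -/
noncomputable def Theta {X : Type*} [MeasurableSpace X]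
    (κ : Kernel X X) (ν : Measure X) (Ω : Set X) (u : X → ℝ) (p : ℝ) : ℝ≥0∞ :=
  ∫⁻ x in mBoundary κ Ω, ∫⁻ y in Ω, ENNReal.ofReal (|u y - u x| ^ (p - 1)) ∂(κ x) ∂ν

theorem measurableSet_mBoundary {X : Type*} [MeasurableSpace X] (κ : Kernel X X) {Ω : Set X}
    (hΩ : MeasurableSet Ω) : MeasurableSet (mBoundary κ Ω) :=
  hΩ.compl.inter (measurableSet_lt measurable_const (κ.measurable_coe hΩ))

/-- A finite `T` with `T ≤ A + B * T ^ α` and `0 < α < 1` is bounded in terms of `A`, `B`, `α`. -/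
theorem ENNReal.le_of_le_add_mul_rpow {A B T : ℝ≥0∞} {α : ℝ} (hα : 0 < α) (hα' : α < 1)
    (hT : T ≠ ⊤) (h : T ≤ A + B * T ^ α) : T ≤ max 1 ((A + B) ^ (1 - α)⁻¹) := by
  rcases le_total T 1 with h1 | h1
  · exact h1.trans (le_max_left _ _)
  refine le_max_of_le_right ?_
  have h0 : T ≠ 0 := (zero_lt_one.trans_le h1).ne'
  rw [ENNReal.le_rpow_inv_iff (by linarith), ENNReal.rpow_sub _ _ h0 hT, ENNReal.rpow_one]
  refine ENNReal.div_le_of_le_mul (h.trans ?_)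
  rw [add_mul]
  gcongr
  exact le_mul_of_one_le_right' (ENNReal.one_le_rpow h1 hα)

/-- For a reversible measure, integrating a function of the endpoint of one random walk step
gives back its integral. -/
theorem lintegral_lintegral_of_reversible {X : Type*} [MeasurableSpace X] {κ : Kernel X X}
    [IsMarkovKernel κ] {ν : Measure X} [SFinite ν]
    (hrev : (ν ⊗ₘ κ).map Prod.swap = ν ⊗ₘ κ) {g : X → ℝ≥0∞} (hg : Measurable g) :
    ∫⁻ x, ∫⁻ y, g y ∂(κ x) ∂ν = ∫⁻ x, g x ∂ν := by
  calc ∫⁻ x, ∫⁻ y, g y ∂(κ x) ∂ν = ∫⁻ z, g z.2 ∂(ν ⊗ₘ κ) :=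
        (Measure.lintegral_compProd (hg.comp measurable_snd)).symm
    _ = ∫⁻ z, g z.1 ∂(ν ⊗ₘ κ) := by
        nth_rw 1 [← hrev]
        exact lintegral_map (hg.comp measurable_snd) measurable_swap
    _ = ∫⁻ x, g x ∂ν := by
        rw [Measure.lintegral_compProd (f := fun z => g z.1) (by fun_prop)]
        simp

/-- Pointwise consequence of growth and coercivity: `t` is the value of `a_p` at
`r = v - w`, and `s` is a sign of `w`. -/
theorem coercive_pointwise_bound {p c C v w t s : ℝ} (hp : 2 < p) (hc : 0 < c) (hC : 0 < C)
    (hgrowth : |t| ≤ C * (1 + |v - w| ^ (p - 1))) (hcoer : c * |v - w| ^ p ≤ t * (v - w))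
    (hs : |s| ≤ 1) (hsw : s * w = |w|) :
    c * |v - w| ^ (p - 1) ≤
      (c + 2 * C) + (c + 2 * C) * (|v - w| ^ (p - 2) * |v|) - s * t := by
  set r := v - w with hr
  have hst : s * t ≤ |t| := by
    calc s * t ≤ |s * t| := le_abs_self _
      _ = |s| * |t| := abs_mul _ _
      _ ≤ 1 * |t| := by gcongr
      _ = |t| := one_mul _
  rcases le_or_gt |r| 1 with h1 | h1
  · have hle : |r| ^ (p - 1) ≤ 1 := Real.rpow_le_one (abs_nonneg _) h1 (by linarith)
    have h2 : 0 ≤ (c + 2 * C) * (|r| ^ (p - 2) * |v|) := by positivity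
    nlinarith
  · have hr0 : 0 < |r| := by linarith
    have hrne : r ≠ 0 := abs_pos.mp hr0
    set m := |r| ^ (p - 2) with hm
    have hm0 : 0 < m := by positivity
    have e1 : |r| ^ (p - 1) = m * |r| := by
      rw [hm, ← Real.rpow_add_one hr0.ne']; ring_nf
    have e2 : |r| ^ p = m * (r * r) := by
      rw [← abs_mul_abs_self r, ← mul_assoc, ← e1, ← Real.rpow_add_one hr0.ne']; ring_nf
    have hone : 1 ≤ m * |r| := by
      rw [← e1]; exact Real.one_le_rpow h1.le (by linarith)
    rw [e1] at hgrowth ⊢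
    rw [e2] at hcoer
    obtain ⟨q, rfl⟩ : ∃ q, t = q * r := ⟨t / r, by field_simp⟩
    have hrr : 0 < r * r := mul_self_pos.mpr hrne
    have hq : c * m ≤ q := by
      refine le_of_mul_le_mul_right ?_ hrr
      linarith
    have hq0 : 0 ≤ q := le_trans (by positivity) hq
    have hq' : q ≤ 2 * C * m := by
      rw [abs_mul, abs_of_nonneg hq0] at hgrowth
      refine le_of_mul_le_mul_right ?_ hr0
      nlinarith
    have htri : |r| ≤ |v| + |w| := abs_sub v w
    have hsv : s * v ≤ |v| := by
      calc s * v ≤ |s * v| := le_abs_self _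
        _ = |s| * |v| := abs_mul _ _
        _ ≤ 1 * |v| := by gcongr
        _ = |v| := one_mul _
    have hv := abs_nonneg v
    have hw := abs_nonneg w
    have k1 : c * m * |r| ≤ c * m * |v| + c * m * |w| := by
      rw [← mul_add]; gcongr
    have k2 : c * m * |w| ≤ q * |w| := by gcongr
    have k3 : q * (s * v) ≤ 2 * C * m * |v| :=
      (mul_le_mul_of_nonneg_left hsv hq0).trans (by gcongr)
    have k4 : q * |w| = q * (s * v) - s * (q * r) := by rw [← hsw, hr]; ring
    linarith

/-- The estimate at a single boundary point, with `b` playing the role of `a_p(x, ·, u - w)` and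
`w` that of `u x`. -/
theorem boundary_point_estimate {X : Type*} [MeasurableSpace X] {μ : Measure X}
    [IsFiniteMeasure μ] {p c C w : ℝ} (hp : 2 < p) (hc : 0 < c) (hC : 0 < C) (hμ : μ Set.univ ≤ 1)
    {u b : X → ℝ} (hum : Measurable u) (hb : Integrable b μ)
    (hgrowth : ∀ y, |b y| ≤ C * (1 + |u y - w| ^ (p - 1)))
    (hcoer : ∀ y, c * |u y - w| ^ p ≤ b y * (u y - w)) :
    ∫⁻ y, ENNReal.ofReal (|u y - w| ^ (p - 1)) ∂μ < ⊤ ∧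
    ∫⁻ y, ENNReal.ofReal (|u y - w| ^ (p - 1)) ∂μ ≤
      ENNReal.ofReal (1 + 2 * C / c) + ENNReal.ofReal (1 / c) * ENNReal.ofReal |∫ y, b y ∂μ|
        + ENNReal.ofReal (1 + 2 * C / c) *
          ∫⁻ y, ENNReal.ofReal (|u y - w| ^ (p - 2)) * ENNReal.ofReal |u y| ∂μ := by
  have hpow (y : X) : c * |u y - w| ^ (p - 1) ≤ |b y| := by
    rcases eq_or_ne (u y - w) 0 with h0 | h0
    · rw [h0, abs_zero, Real.zero_rpow (by linarith), mul_zero]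
      exact abs_nonneg _
    · have hr0 : 0 < |u y - w| := abs_pos.mpr h0
      refine le_of_mul_le_mul_right ?_ hr0
      rw [mul_assoc, ← Real.rpow_add_one hr0.ne', sub_add_cancel, ← abs_mul]
      exact (hcoer y).trans (le_abs_self _)
  have hmeas (q : ℝ) : Measurable fun y => |u y - w| ^ q := by fun_prop
  have hrint : Integrable (fun y => |u y - w| ^ (p - 1)) μ := by
    refine (hb.abs.const_mul c⁻¹).mono' (hmeas _).aestronglyMeasurable (.of_forall fun y => ?_)
    rw [Real.norm_of_nonneg (by positivity), ← div_eq_inv_mul, le_div_iff₀' hc]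
    exact hpow y
  have hintm : Integrable (fun y => |u y - w| ^ (p - 2)) μ := by
    refine ((integrable_const 1).add hrint).mono' (hmeas _).aestronglyMeasurable
      (.of_forall fun y => ?_)
    rw [Real.norm_of_nonneg (by positivity)]
    change _ ≤ 1 + |u y - w| ^ (p - 1)
    rcases le_total |u y - w| 1 with h | h
    · exact (Real.rpow_le_one (abs_nonneg _) h (by linarith)).trans
        (le_add_of_nonneg_right (by positivity))
    · exact (Real.rpow_le_rpow_of_exponent_le h (by linarith)).trans
        (le_add_of_nonneg_left zero_le_one)
  have hintu : Integrable (fun y => |u y - w| ^ (p - 2) * |u y|) μ := by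
    refine (hrint.add (hintm.mul_const |w|)).mono'
      ((hmeas _).mul (measurable_norm.comp hum)).aestronglyMeasurable (.of_forall fun y => ?_)
    rw [Real.norm_of_nonneg (by positivity)]
    change _ ≤ |u y - w| ^ (p - 1) + |u y - w| ^ (p - 2) * |w|
    have e1 : |u y - w| ^ (p - 1) = |u y - w| ^ (p - 2) * |u y - w| := by
      rw [← Real.rpow_add_one' (abs_nonneg _) (by linarith)]; ring_nf
    rw [e1, ← mul_add]
    gcongr
    simpa using abs_add_le (u y - w) w
  obtain ⟨s, hs, hsw⟩ : ∃ s : ℝ, |s| ≤ 1 ∧ s * w = |w| := by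
    rcases le_total 0 w with h | h
    · exact ⟨1, by simp, by simp [abs_of_nonneg h]⟩
    · exact ⟨-1, by simp, by simp [abs_of_nonpos h]⟩
  have hreal : c * ∫ y, |u y - w| ^ (p - 1) ∂μ ≤
      (c + 2 * C) + (c + 2 * C) * (∫ y, |u y - w| ^ (p - 2) * |u y| ∂μ) + |∫ y, b y ∂μ| := by
    have hmass : μ.real Set.univ ≤ 1 := ENNReal.toReal_mono ENNReal.one_ne_top hμ
    have hi1 : Integrable (fun _ : X => c + 2 * C) μ := integrable_const _
    have hi2 : Integrable (fun y => (c + 2 * C) * (|u y - w| ^ (p - 2) * |u y|)) μ :=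
      hintu.const_mul _
    have hi3 : Integrable (fun y => s * b y) μ := hb.const_mul _
    calc c * ∫ y, |u y - w| ^ (p - 1) ∂μ = ∫ y, c * |u y - w| ^ (p - 1) ∂μ :=
          (integral_const_mul _ _).symm
      _ ≤ ∫ y, ((c + 2 * C) + (c + 2 * C) * (|u y - w| ^ (p - 2) * |u y|) - s * b y) ∂μ :=
          integral_mono (hrint.const_mul _) ((hi1.add hi2).sub hi3) fun y =>
            coercive_pointwise_bound hp hc hC (hgrowth y) (hcoer y) hs hsw
      _ = μ.real Set.univ * (c + 2 * C)
            + (c + 2 * C) * (∫ y, |u y - w| ^ (p - 2) * |u y| ∂μ) - s * ∫ y, b y ∂μ := by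
          refine (integral_sub (hi1.add hi2) hi3).trans ?_
          rw [integral_const_mul s, integral_add' hi1 hi2, integral_const, integral_const_mul,
            smul_eq_mul]
      _ ≤ _ := by
          have h1 : μ.real Set.univ * (c + 2 * C) ≤ 1 * (c + 2 * C) := by gcongr
          have h2 : -(s * ∫ y, b y ∂μ) ≤ |∫ y, b y ∂μ| := by
            calc -(s * ∫ y, b y ∂μ) ≤ |s * ∫ y, b y ∂μ| := neg_le_abs _
              _ = |s| * |∫ y, b y ∂μ| := abs_mul _ _
              _ ≤ 1 * |∫ y, b y ∂μ| := by gcongr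
              _ = _ := one_mul _
          linarith
  have hnonneg : 0 ≤ ∫ y, |u y - w| ^ (p - 2) * |u y| ∂μ :=
    integral_nonneg fun y => by positivity
  have hdiv : ∫ y, |u y - w| ^ (p - 1) ∂μ ≤ (1 + 2 * C / c) + 1 / c * |∫ y, b y ∂μ|
      + (1 + 2 * C / c) * ∫ y, |u y - w| ^ (p - 2) * |u y| ∂μ := by
    rw [← mul_le_mul_iff_right₀ hc]
    refine hreal.trans_eq ?_
    field_simp
    ring
  have e := ofReal_integral_eq_lintegral_ofReal hrint (.of_forall fun y => by positivity)
  have e' := ofReal_integral_eq_lintegral_ofReal hintu (.of_forall fun y => by positivity)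
  simp_rw [← ENNReal.ofReal_mul (Real.rpow_nonneg (abs_nonneg _) _)]
  rw [← e, ← e']
  refine ⟨ENNReal.ofReal_lt_top, ?_⟩
  rw [← ENNReal.ofReal_mul (by positivity), ← ENNReal.ofReal_mul (by positivity),
    ← ENNReal.ofReal_add (by positivity) (by positivity),
    ← ENNReal.ofReal_add (by positivity) (by positivity)]
  exact ENNReal.ofReal_le_ofReal hdiv

/-- Hölder's inequality and reversibility applied to the cross term. -/
theorem lintegral_cross_term_le {X : Type*} [MeasurableSpace X] {κ : Kernel X X}
    [IsMarkovKernel κ] {ν : Measure X} [SFinite ν]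
    (hrev : (ν ⊗ₘ κ).map Prod.swap = ν ⊗ₘ κ) {Ω : Set X} (hΩ : MeasurableSet Ω)
    {p : ℝ} (hp : 2 < p) {u : X → ℝ} (hum : Measurable u) (D : Set X) :
    ∫⁻ x in D, ∫⁻ y in Ω, ENNReal.ofReal (|u y - u x| ^ (p - 2)) * ENNReal.ofReal |u y|
        ∂(κ x) ∂ν ≤
      (∫⁻ x in D, ∫⁻ y in Ω, ENNReal.ofReal (|u y - u x| ^ (p - 1)) ∂(κ x) ∂ν)
          ^ ((p - 2) / (p - 1)) *
        (∫⁻ x in Ω, ENNReal.ofReal (|u x| ^ (p - 1)) ∂ν) ^ (1 / (p - 1)) := by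
  have hp1 : 0 < p - 1 := by linarith
  have hp2 : 0 < p - 2 := by linarith
  have hcomp {f : X × X → ℝ≥0∞} (hf : Measurable f) :
      ∫⁻ x in D, ∫⁻ y in Ω, f (x, y) ∂(κ x) ∂ν =
        ∫⁻ z, f z ∂((ν.restrict D) ⊗ₘ (κ.restrict hΩ)) := by
    rw [Measure.lintegral_compProd hf]
    simp_rw [Kernel.restrict_apply]
  have hf : Measurable fun z : X × X => ENNReal.ofReal (|u z.2 - u z.1| ^ (p - 2)) := by fun_prop
  have hg : Measurable fun z : X × X => ENNReal.ofReal |u z.2| :=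
    (measurable_norm.comp (hum.comp measurable_snd)).ennreal_ofReal
  have hgu : Measurable fun y => ENNReal.ofReal (|u y| ^ (p - 1)) := by fun_prop
  have hpq : ((p - 1) / (p - 2)).HolderConjugate (p - 1) := by
    rw [Real.holderConjugate_iff]
    refine ⟨by rw [lt_div_iff₀ hp2]; linarith, by field_simp; ring⟩
  refine (hcomp (hf.mul hg)).trans_le ?_
  refine (ENNReal.lintegral_mul_le_Lp_mul_Lq _ hpq hf.aemeasurable hg.aemeasurable).trans ?_
  rw [one_div_div]
  refine mul_le_mul' (ENNReal.rpow_le_rpow (le_of_eq ?_) (by positivity))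
    (ENNReal.rpow_le_rpow ?_ (by positivity))
  · rw [hcomp (f := fun z => ENNReal.ofReal (|u z.2 - u z.1| ^ (p - 1))) (by fun_prop)]
    refine lintegral_congr fun z => ?_
    rw [ENNReal.ofReal_rpow_of_nonneg (by positivity) (by positivity),
      ← Real.rpow_mul (abs_nonneg _), mul_div_cancel₀ _ hp2.ne']
  · calc ∫⁻ z, ENNReal.ofReal |u z.2| ^ (p - 1) ∂((ν.restrict D) ⊗ₘ (κ.restrict hΩ))
        = ∫⁻ x in D, ∫⁻ y in Ω, ENNReal.ofReal (|u y| ^ (p - 1)) ∂(κ x) ∂ν := by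
          rw [hcomp (f := fun z => ENNReal.ofReal (|u z.2| ^ (p - 1))) (by fun_prop)]
          refine lintegral_congr fun z => ?_
          rw [ENNReal.ofReal_rpow_of_nonneg (abs_nonneg _) hp1.le]
      _ ≤ ∫⁻ x, ∫⁻ y in Ω, ENNReal.ofReal (|u y| ^ (p - 1)) ∂(κ x) ∂ν :=
          setLIntegral_le_lintegral _ _
      _ = ∫⁻ x, ∫⁻ y, Ω.indicator (fun y => ENNReal.ofReal (|u y| ^ (p - 1))) y ∂(κ x) ∂ν := by
          simp_rw [lintegral_indicator hΩ]
      _ = ∫⁻ x in Ω, ENNReal.ofReal (|u x| ^ (p - 1)) ∂ν := by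
          rw [lintegral_lintegral_of_reversible hrev (hgu.indicator hΩ), lintegral_indicator hΩ]

/-- Under the Dipierro–Ros-Oton–Valdinoci boundary condition with
`u ∈ L^{p-1}(Ω,ν)`, `p > 2`, `φ ∈ L¹(∂_mΩ,ν)`, growth `|a_p| ≤ C(1+|r|^{p-1})` and
coercivity `a_p(x,y,r) r ≥ c|r|^p`, the quantity `Θ` satisfies the self-improving bound
`Θ ≤ (1+2C/c) ν(Ω_m) + (1/c)‖φ‖_{L¹} + (1+2C/c) Θ^{(p-2)/(p-1)} ‖u‖_{L^{p-1}(Ω,ν)}`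
and consequently `Θ < +∞`. -/
theorem theta_self_improving_bound
    {X : Type*} [MeasurableSpace X]
    (κ : Kernel X X) [IsMarkovKernel κ]
    (ν : Measure X) [SigmaFinite ν]
    (habs : ∀ x, κ x ≪ ν)
    (hrev : (ν ⊗ₘ κ).map Prod.swap = ν ⊗ₘ κ)
    (Ω : Set X) (hΩ : MeasurableSet Ω)
    (hfin : ν (mClosure κ Ω) < ⊤)
    (p c C : ℝ) (hp : 2 < p) (hc : 0 < c) (hC : 0 < C)
    (a : X → X → ℝ → ℝ)
    (ham : Measurable (fun z : (X × X) × ℝ => a z.1.1 z.1.2 z.2))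
    (hgrowth : ∀ x y : X, ∀ r : ℝ, |a x y r| ≤ C * (1 + |r| ^ (p - 1)))
    (hcoer : ∀ x y : X, ∀ r : ℝ, c * |r| ^ p ≤ a x y r * r)
    (u : X → ℝ) (hum : Measurable u)
    (huL : ∫⁻ x in Ω, ENNReal.ofReal (|u x| ^ (p - 1)) ∂ν ≠ ⊤)
    (φ : X → ℝ) (hφint : Integrable φ (ν.restrict (mBoundary κ Ω)))
    (hbc : ∀ᵐ x ∂(ν.restrict (mBoundary κ Ω)),
      Integrable (fun y => a x y (u y - u x)) ((κ x).restrict Ω) ∧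
        - ∫ y in Ω, a x y (u y - u x) ∂(κ x) = φ x) :
    Theta κ ν Ω u p
      ≤ ENNReal.ofReal (1 + 2 * C / c) * ν (mClosure κ Ω)
        + ENNReal.ofReal (1 / c) * (∫⁻ x in mBoundary κ Ω, ENNReal.ofReal |φ x| ∂ν)
        + ENNReal.ofReal (1 + 2 * C / c) * (Theta κ ν Ω u p) ^ ((p - 2) / (p - 1)) *
            (∫⁻ x in Ω, ENNReal.ofReal (|u x| ^ (p - 1)) ∂ν) ^ (1 / (p - 1))
    ∧ Theta κ ν Ω u p < ⊤ := by
  set S := mBoundary κ Ω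
  have hSm : MeasurableSet S := measurableSet_mBoundary κ hΩ
  set θ : X → ℝ≥0∞ := fun x => ∫⁻ y in Ω, ENNReal.ofReal (|u y - u x| ^ (p - 1)) ∂(κ x)
  set A := ENNReal.ofReal (1 + 2 * C / c) * ν (mClosure κ Ω)
        + ENNReal.ofReal (1 / c) * (∫⁻ x in S, ENNReal.ofReal |φ x| ∂ν) with hA
  set N := (∫⁻ x in Ω, ENNReal.ofReal (|u x| ^ (p - 1)) ∂ν) ^ (1 / (p - 1))
  set k := ENNReal.ofReal (1 + 2 * C / c)
  have hθm : Measurable θ := by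
    have h := Measurable.lintegral_kernel_prod_right' (κ := κ.restrict hΩ)
      (f := fun z : X × X => ENNReal.ofReal (|u z.2 - u z.1| ^ (p - 1))) (by fun_prop)
    simpa only [Kernel.restrict_apply] using h
  have hpt : ∀ᵐ x ∂(ν.restrict S), θ x < ⊤ ∧ θ x ≤
      k + ENNReal.ofReal (1 / c) * ENNReal.ofReal |φ x| + k *
        ∫⁻ y in Ω, ENNReal.ofReal (|u y - u x| ^ (p - 2)) * ENNReal.ofReal |u y| ∂(κ x) := by
    filter_upwards [hbc] with x ⟨hbint, hx⟩
    rw [← hx, abs_neg]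
    exact boundary_point_estimate hp hc hC
      ((Measure.restrict_apply_univ Ω).trans_le prob_le_one) hum hbint
      (fun y => hgrowth x y _) (fun y => hcoer x y _)
  have hbound {D : Set X} (hD : D ⊆ S) :
      ∫⁻ x in D, θ x ∂ν ≤ A + k * (∫⁻ x in D, θ x ∂ν) ^ ((p - 2) / (p - 1)) * N := by
    have hνD : ν.restrict D ≤ ν.restrict S := Measure.restrict_mono_set ν hD
    have hφm : AEMeasurable (fun x => ENNReal.ofReal |φ x|) (ν.restrict D) :=
      (hφint.1.aemeasurable.mono_measure hνD).abs.ennreal_ofReal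
    calc ∫⁻ x in D, θ x ∂ν
        ≤ ∫⁻ x in D, (k + ENNReal.ofReal (1 / c) * ENNReal.ofReal |φ x| + k *
            ∫⁻ y in Ω, ENNReal.ofReal (|u y - u x| ^ (p - 2)) * ENNReal.ofReal |u y| ∂(κ x)) ∂ν :=
          lintegral_mono_ae ((hpt.filter_mono (ae_mono hνD)).mono fun x hx => hx.2)
      _ = k * ν D + ENNReal.ofReal (1 / c) * (∫⁻ x in D, ENNReal.ofReal |φ x| ∂ν) + k *
            ∫⁻ x in D, ∫⁻ y in Ω, ENNReal.ofReal (|u y - u x| ^ (p - 2)) * ENNReal.ofReal |u y|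
              ∂(κ x) ∂ν := by
          refine (lintegral_add_left' (aemeasurable_const.add (hφm.const_mul _)) _).trans ?_
          simp only [Pi.add_apply]
          rw [lintegral_add_left' aemeasurable_const, setLIntegral_const,
            lintegral_const_mul' _ _ ENNReal.ofReal_ne_top,
            lintegral_const_mul' _ _ ENNReal.ofReal_ne_top]
      _ ≤ _ := by
          rw [mul_assoc k _ N, hA]
          gcongr
          · exact hD.trans Set.subset_union_right
          · exact lintegral_cross_term_le hrev hΩ hp hum D
  refine ⟨hbound subset_rfl, ?_⟩
  have hα : 0 < (p - 2) / (p - 1) := div_pos (by linarith) (by linarith)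
  have hα' : (p - 2) / (p - 1) < 1 := by rw [div_lt_one (by linarith)]; linarith
  set M := max 1 ((A + k * N) ^ (1 - (p - 2) / (p - 1))⁻¹)
  have hφtop : ∫⁻ x in S, ENNReal.ofReal |φ x| ∂ν ≠ ⊤ := by
    have h := hφint.2.ne
    simp_rw [← Real.norm_eq_abs, ofReal_norm]
    exact h
  have hMtop : M < ⊤ := by
    have hNtop : N ≠ ⊤ := ENNReal.rpow_ne_top_of_nonneg (by simp; linarith) huL
    refine max_lt ENNReal.one_lt_top (ENNReal.rpow_lt_top_of_nonneg (by simp; linarith) ?_)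
    finiteness
  set D : ℕ → Set X := fun n => S ∩ {x | θ x ≤ n}
  have hDm (n : ℕ) : MeasurableSet (D n) := hSm.inter (measurableSet_le hθm measurable_const)
  have hDle (n : ℕ) : ∫⁻ x in D n, θ x ∂ν ≤ M := by
    have hfinD : ∫⁻ x in D n, θ x ∂ν ≠ ⊤ := by
      refine ((setLIntegral_mono measurable_const fun x hx => hx.2).trans_lt ?_).ne
      rw [setLIntegral_const]
      refine ENNReal.mul_lt_top (ENNReal.natCast_lt_top n) ((measure_mono ?_).trans_lt hfin)
      exact Set.inter_subset_left.trans Set.subset_union_right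
    refine ENNReal.le_of_le_add_mul_rpow hα hα' hfinD ?_
    rw [mul_right_comm]
    exact hbound Set.inter_subset_left
  have hmono : Monotone D := fun i j hij x hx => ⟨hx.1, hx.2.out.trans (Nat.cast_le.mpr hij)⟩
  have hUnion : (⋃ n, D n : Set X) =ᵐ[ν] S := by
    filter_upwards [(ae_restrict_iff' hSm).mp hpt] with x hx
    refine propext ⟨fun h => ?_, fun h => ?_⟩
    · obtain ⟨n, hn⟩ := Set.mem_iUnion.mp h
      exact hn.1
    · obtain ⟨n, hn⟩ := ENNReal.exists_nat_gt (hx h).1.ne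
      exact Set.mem_iUnion.mpr ⟨n, h, hn.le⟩
  have hΘ : Theta κ ν Ω u p = ⨆ n, ∫⁻ x in D n, θ x ∂ν := by
    calc Theta κ ν Ω u p = ∫⁻ x in ⋃ n, D n, θ x ∂ν := (setLIntegral_congr hUnion).symm
      _ = _ := setLIntegral_iUnion_of_directed _ hmono.directed_le
  rw [hΘ]
  exact (iSup_le hDle).trans_lt hMtop
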